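/- arXiv:1811.08089 — 2 statements merged into one kernel-verified Lean document; each statement's English description precedes it below -/
import Mathlib

section
/- Let P be a 2×2 real matrix with all entries strictly positive and P_{11} < 1 − P_{12}, and define f: (P_{11}, 1−P_{12}) → ℝ by f(x) = P_{21}/(1 − P_{11}/x) + P_{22}/(1 − P_{12}/(1−x)). Then P ∈ D(2,2) if and only if there exists x ∈ (P_{11}, 1−P_{12}) with f(x) = 1; moreover f attains its global minimum on (P_{11}, 1−P_{12}) at x* = λP_{11} + (1−λ)(1−P_{12}) with λ = √(P_{12}P_{22}) / (√(P_{11}P_{21}) + √(P_{12}P_{22})), and f(x) → ∞ as x approaches either endpoint of the interval. -/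
open scoped Classical

notation "⟪" x ", " y "⟫_ℂ" => @inner ℂ _ _ x y

noncomputable section

/-- A POVM over a finite index type `Ω`: a family of positive semidefinite operators
on `H` summing to the identity. -/
def IsPOVM {H : Type*} [NormedAddCommGroup H] [InnerProductSpace ℂ H]
    {Ω : Type*} [Fintype Ω] (M : Ω → H →ₗ[ℂ] H) : Prop :=
  (∀ ω x, 0 ≤ (⟪x, M ω x⟫_ℂ).re ∧ (⟪x, M ω x⟫_ℂ).im = 0) ∧
    ∑ ω, M ω = LinearMap.id

/-- `(φA, φB)` is perfectly distinguishable by post-processing. -/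
def PerfectlyDistinguishable {H : Type*} [NormedAddCommGroup H] [InnerProductSpace ℂ H]
    {KA KB : Type*} [Fintype KA] [Fintype KB] (φA : KA → H) (φB : KB → H) : Prop :=
  ∃ (N : ℕ) (M : Fin N → H →ₗ[ℂ] H) (fA : Fin N → KA) (fB : Fin N → KB),
    IsPOVM M ∧
    (∀ a, ∑ ω ∈ Finset.univ.filter (fun ω => fA ω = a), ⟪φA a, M ω (φA a)⟫_ℂ = 1) ∧
    (∀ b, ∑ ω ∈ Finset.univ.filter (fun ω => fB ω = b), ⟪φB b, M ω (φB b)⟫_ℂ = 1)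

/-- A standard pair in `ℂ^{K_A × K_B}`. -/
def IsStandardPair {KA KB : Type*} [Fintype KA] [Fintype KB]
    (ΦA : KA → EuclideanSpace ℂ (KA × KB)) (ΦB : KB → EuclideanSpace ℂ (KA × KB)) : Prop :=
  ∃ (α β : KA → KB → ℂ),
    (∀ a, ∑ b, ‖α a b‖ ^ 2 = 1) ∧ (∀ b, ∑ a, ‖β a b‖ ^ 2 = 1) ∧
    (∀ a, ΦA a = ∑ b, α a b • EuclideanSpace.single (a, b) (1 : ℂ)) ∧
    (∀ b, ΦB b = ∑ a, β a b • EuclideanSpace.single (a, b) (1 : ℂ))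

/-- Right stochastic matrix: nonnegative entries, rows sum to 1. -/
def RightStochastic {n m : Type*} [Fintype m] (A : Matrix n m ℝ) : Prop :=
  (∀ i j, 0 ≤ A i j) ∧ ∀ i, ∑ j, A i j = 1

/-- Left stochastic matrix: nonnegative entries, columns sum to 1. -/
def LeftStochastic {n m : Type*} [Fintype n] (B : Matrix n m ℝ) : Prop :=
  (∀ i j, 0 ≤ B i j) ∧ ∀ j, ∑ i, B i j = 1

/-- Membership in `D̄(n,m)`: decomposable into an entrywise product of a right
stochastic matrix and a left stochastic matrix. -/
def MemDBar {n m : Type*} [Fintype n] [Fintype m] (P : Matrix n m ℝ) : Prop :=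
  ∃ A B : Matrix n m ℝ, RightStochastic A ∧ LeftStochastic B ∧ ∀ i j, P i j = A i j * B i j

/-- Membership in `D(n,m)`: members of `D̄(n,m)` with all entries strictly positive. -/
def MemD {n m : Type*} [Fintype n] [Fintype m] (P : Matrix n m ℝ) : Prop :=
  MemDBar P ∧ ∀ i j, 0 < P i j

/-- A measurement table for `(φA, φB)`. -/
def IsMeasurementTable {H : Type*} [NormedAddCommGroup H] [InnerProductSpace ℂ H]
    {KA KB : Type*} [Fintype KA] [Fintype KB]
    (φA : KA → H) (φB : KB → H) (M : KA × KB → H →ₗ[ℂ] H) : Prop :=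
  IsPOVM M ∧
    (∀ a, ∑ b, ⟪φA a, M (a, b) (φA a)⟫_ℂ = 1) ∧
    (∀ b, ∑ a, ⟪φB b, M (a, b) (φB b)⟫_ℂ = 1)


theorem memD_of_fin_two_iff {P : Matrix (Fin 2) (Fin 2) ℝ} (hpos : ∀ i j, 0 < P i j) :
    MemD P ↔ ∃ x ∈ Set.Ioo (P 0 0) (1 - P 0 1),
      P 1 0 / (1 - P 0 0 / x) + P 1 1 / (1 - P 0 1 / (1 - x)) = 1 := by
  have ha := hpos 0 0
  have hb := hpos 0 1
  have hc := hpos 1 0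
  have hd := hpos 1 1
  constructor
  · rintro ⟨⟨A, B, ⟨hA, hAs⟩, ⟨hB, hBs⟩, hP⟩, -⟩
    have hA' : ∀ i j, 0 < A i j := fun i j =>
      (hA i j).lt_of_ne fun h => (hpos i j).ne' (by rw [hP, ← h, zero_mul])
    have hB' : ∀ i j, 0 < B i j := fun i j =>
      (hB i j).lt_of_ne fun h => (hpos i j).ne' (by rw [hP, ← h, mul_zero])
    simp only [Fin.sum_univ_two] at hAs hBs
    have hA01 : 1 - A 0 0 = A 0 1 := by linarith [hAs 0]
    have hB10 : 1 - B 0 0 = B 1 0 := by linarith [hBs 0]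
    have hB11 : 1 - B 0 1 = B 1 1 := by linarith [hBs 1]
    refine ⟨A 0 0, ⟨?_, ?_⟩, ?_⟩
    · rw [hP]
      exact mul_lt_of_lt_one_right (hA' 0 0) (by linarith [hB' 1 0])
    · rw [hP]
      linarith [mul_lt_of_lt_one_right (hA' 0 1) (show B 0 1 < 1 by linarith [hB' 1 1])]
    · rw [hA01, hP 0 0, hP 0 1, hP 1 0, hP 1 1, mul_div_cancel_left₀ _ (hA' 0 0).ne',
        mul_div_cancel_left₀ _ (hA' 0 1).ne', hB10, hB11,
        mul_div_cancel_right₀ _ (hB' 1 0).ne', mul_div_cancel_right₀ _ (hB' 1 1).ne', hAs 1]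
  · rintro ⟨x, ⟨hax, hxb⟩, hx⟩
    have hx0 : 0 < x := ha.trans hax
    have hx1 : 0 < 1 - x := by linarith
    have hs : 0 < 1 - P 0 0 / x := sub_pos.2 ((div_lt_one hx0).2 hax)
    have ht : 0 < 1 - P 0 1 / (1 - x) := sub_pos.2 ((div_lt_one hx1).2 (by linarith))
    refine ⟨⟨!![x, 1 - x; P 1 0 / (1 - P 0 0 / x), P 1 1 / (1 - P 0 1 / (1 - x))],
      !![P 0 0 / x, P 0 1 / (1 - x); 1 - P 0 0 / x, 1 - P 0 1 / (1 - x)],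
      ⟨?_, ?_⟩, ⟨?_, ?_⟩, ?_⟩, hpos⟩
    · simp only [Fin.forall_fin_two]
      exact ⟨⟨hx0.le, hx1.le⟩, (div_pos hc hs).le, (div_pos hd ht).le⟩
    · simp [Fin.forall_fin_two, hx]
    · simp only [Fin.forall_fin_two]
      exact ⟨⟨(div_pos ha hx0).le, (div_pos hb hx1).le⟩, hs.le, ht.le⟩
    · simp [Fin.forall_fin_two]
    · simp only [Fin.forall_fin_two]
      exact ⟨⟨(mul_div_cancel₀ _ hx0.ne').symm, (mul_div_cancel₀ _ hx1.ne').symm⟩,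
        (div_mul_cancel₀ _ hs.ne').symm, (div_mul_cancel₀ _ ht.ne').symm⟩

theorem div_one_sub_div_eq_add {a c x : ℝ} (hx : x ≠ 0) (hax : x - a ≠ 0) :
    c / (1 - a / x) = c + a * c / (x - a) := by
  have h : 1 - a / x = (x - a) / x := by field_simp
  rw [h]
  field_simp
  ring

theorem sq_add_div_le_sq_div_add_sq_div (p q : ℝ) {u v : ℝ} (hu : 0 < u) (hv : 0 < v) :
    (p + q) ^ 2 / (u + v) ≤ p ^ 2 / u + q ^ 2 / v := by
  rw [div_add_div _ _ hu.ne' hv.ne', div_le_div_iff₀ (by positivity) (by positivity)]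
  nlinarith [sq_nonneg (p * v - q * u)]

theorem tendsto_const_div_sub_atTop {a k : ℝ} (hk : 0 < k) :
    Filter.Tendsto (fun x => k / (x - a)) (nhdsWithin a (Set.Ioi a)) Filter.atTop := by
  have h : Filter.Tendsto (fun x => x - a) (nhdsWithin a (Set.Ioi a))
      (nhdsWithin 0 (Set.Ioi 0)) := by
    refine tendsto_nhdsWithin_iff.2 ⟨?_, ?_⟩
    · exact ((continuous_id.sub continuous_const).tendsto' a 0 (sub_self a)).mono_left
        nhdsWithin_le_nhds
    · filter_upwards [self_mem_nhdsWithin] with x hx using Set.mem_Ioi.2 (sub_pos.2 (by simpa using hx))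
  simpa only [div_eq_mul_inv, Function.comp_apply] using (tendsto_inv_nhdsGT_zero.comp h).const_mul_atTop hk

theorem tendsto_const_div_sub_atTop_left {a k : ℝ} (hk : 0 < k) :
    Filter.Tendsto (fun x => k / (a - x)) (nhdsWithin a (Set.Iio a)) Filter.atTop := by
  have h : Filter.Tendsto (fun x => a - x) (nhdsWithin a (Set.Iio a))
      (nhdsWithin 0 (Set.Ioi 0)) := by
    refine tendsto_nhdsWithin_iff.2 ⟨?_, ?_⟩
    · exact ((continuous_const.sub continuous_id).tendsto' a 0 (sub_self a)).mono_left
        nhdsWithin_le_nhds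
    · filter_upwards [self_mem_nhdsWithin] with x hx using Set.mem_Ioi.2 (sub_pos.2 (by simpa using hx))
  simpa only [div_eq_mul_inv, Function.comp_apply] using (tendsto_inv_nhdsGT_zero.comp h).const_mul_atTop hk

/-- Analysis of `D(2,2)` via the function
`f(x) = P₂₁/(1 - P₁₁/x) + P₂₂/(1 - P₁₂/(1-x))` on `(P₁₁, 1 - P₁₂)`:
membership in `D(2,2)` is equivalent to `f(x) = 1` for some `x` in the interval, `f`
attains its global minimum at `x* = λP₁₁ + (1-λ)(1-P₁₂)` with
`λ = √(P₁₂P₂₂)/(√(P₁₁P₂₁) + √(P₁₂P₂₂))`, and `f` tends to `∞` at both endpoints. -/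
theorem memD_two_by_two_via_f (P : Matrix (Fin 2) (Fin 2) ℝ)
    (hpos : ∀ i j, 0 < P i j) (hlt : P 0 0 < 1 - P 0 1)
    (f : ℝ → ℝ)
    (hf : ∀ x, f x = P 1 0 / (1 - P 0 0 / x) + P 1 1 / (1 - P 0 1 / (1 - x))) :
    (MemD P ↔ ∃ x ∈ Set.Ioo (P 0 0) (1 - P 0 1), f x = 1) ∧
    (Real.sqrt (P 0 1 * P 1 1) / (Real.sqrt (P 0 0 * P 1 0) + Real.sqrt (P 0 1 * P 1 1))
          * P 0 0
        + (1 - Real.sqrt (P 0 1 * P 1 1)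
              / (Real.sqrt (P 0 0 * P 1 0) + Real.sqrt (P 0 1 * P 1 1)))
          * (1 - P 0 1) ∈ Set.Ioo (P 0 0) (1 - P 0 1) ∧
      ∀ x ∈ Set.Ioo (P 0 0) (1 - P 0 1),
        f (Real.sqrt (P 0 1 * P 1 1)
              / (Real.sqrt (P 0 0 * P 1 0) + Real.sqrt (P 0 1 * P 1 1)) * P 0 0
            + (1 - Real.sqrt (P 0 1 * P 1 1)
                  / (Real.sqrt (P 0 0 * P 1 0) + Real.sqrt (P 0 1 * P 1 1)))
              * (1 - P 0 1)) ≤ f x) ∧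
    Filter.Tendsto f (nhdsWithin (P 0 0) (Set.Ioo (P 0 0) (1 - P 0 1))) Filter.atTop ∧
    Filter.Tendsto f (nhdsWithin (1 - P 0 1) (Set.Ioo (P 0 0) (1 - P 0 1)))
      Filter.atTop := by
  have ha := hpos 0 0
  have hb := hpos 0 1
  have hc := hpos 1 0
  have hd := hpos 1 1
  have hf' : ∀ x ∈ Set.Ioo (P 0 0) (1 - P 0 1), f x =
      P 1 0 + P 1 1 + (P 0 0 * P 1 0 / (x - P 0 0) + P 0 1 * P 1 1 / (1 - P 0 1 - x)) := by
    rintro x ⟨hax, hxb⟩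
    rw [hf, div_one_sub_div_eq_add (by linarith) (by linarith),
      div_one_sub_div_eq_add (x := 1 - x) (by linarith) (by linarith), sub_right_comm 1 x]
    ring
  refine ⟨by simpa only [hf] using memD_of_fin_two_iff hpos, ?_, ?_, ?_⟩
  · have hp : 0 < Real.sqrt (P 0 0 * P 1 0) := Real.sqrt_pos.2 (mul_pos ha hc)
    have hq : 0 < Real.sqrt (P 0 1 * P 1 1) := Real.sqrt_pos.2 (mul_pos hb hd)
    have hp2 : P 0 0 * P 1 0 = Real.sqrt (P 0 0 * P 1 0) ^ 2 :=
      (Real.sq_sqrt (mul_pos ha hc).le).symm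
    have hq2 : P 0 1 * P 1 1 = Real.sqrt (P 0 1 * P 1 1) ^ 2 :=
      (Real.sq_sqrt (mul_pos hb hd).le).symm
    set p := Real.sqrt (P 0 0 * P 1 0)
    set q := Real.sqrt (P 0 1 * P 1 1)
    have hL : 0 < 1 - P 0 1 - P 0 0 := by linarith
    set y := q / (p + q) * P 0 0 + (1 - q / (p + q)) * (1 - P 0 1) with hy
    have hy1 : y - P 0 0 = p * (1 - P 0 1 - P 0 0) / (p + q) := by
      rw [hy]
      field_simp
      ring
    have hy2 : 1 - P 0 1 - y = q * (1 - P 0 1 - P 0 0) / (p + q) := by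
      rw [hy]
      field_simp
      ring
    have hmem : y ∈ Set.Ioo (P 0 0) (1 - P 0 1) :=
      ⟨sub_pos.1 (hy1 ▸ by positivity), sub_pos.1 (hy2 ▸ by positivity)⟩
    refine ⟨hmem, fun x hx => ?_⟩
    have hmin := sq_add_div_le_sq_div_add_sq_div p q (sub_pos.2 hx.1) (sub_pos.2 hx.2)
    have hval : p ^ 2 / (y - P 0 0) + q ^ 2 / (1 - P 0 1 - y) =
        (p + q) ^ 2 / (x - P 0 0 + (1 - P 0 1 - x)) := by
      have hs : x - P 0 0 + (1 - P 0 1 - x) = 1 - P 0 1 - P 0 0 := by ring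
      rw [hy1, hy2, hs]
      field_simp
    rw [hf' y hmem, hf' x hx, hp2, hq2, hval]
    gcongr
  · refine Filter.tendsto_atTop_mono' _ ?_ ((tendsto_const_div_sub_atTop (mul_pos ha hc)).mono_left
      (nhdsWithin_mono _ Set.Ioo_subset_Ioi_self))
    filter_upwards [self_mem_nhdsWithin] with x hx
    rw [hf' x hx]
    linarith [div_pos (mul_pos hb hd) (sub_pos.2 hx.2)]
  · refine Filter.tendsto_atTop_mono' _ ?_
      ((tendsto_const_div_sub_atTop_left (mul_pos hb hd)).mono_left
        (nhdsWithin_mono _ Set.Ioo_subset_Iio_self))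
    filter_upwards [self_mem_nhdsWithin] with x hx
    rw [hf' x hx]
    linarith [div_pos (mul_pos ha hc) (sub_pos.2 hx.1)]


end
end

section
/- In ℂ³ with orthonormal basis |0⟩, |1⟩, |2⟩, let S^A = ((|0⟩+|1⟩)/√2, (|0⟩−|1⟩)/√2) and S^B = ((|0⟩+|2⟩)/√2, (|0⟩−|2⟩)/√2). Then the family M_{ab} = (3/4)|v_{ab}⟩⟨v_{ab}| for (a,b) ∈ {0,1}², where |v_{ab}⟩ = (|0⟩ + (−1)^a|1⟩ + (−1)^b|2⟩)/√3, is a POVM (each M_{ab} is positive semidefinite and ∑_{ab} M_{ab} = 1) and is a measurement table for (S^A, S^B); consequently (S^A, S^B) is perfectly distinguishable by post-processing even though every state of S^A is non-orthogonal to every state of S^B. -/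
open scoped Classical

noncomputable section

/-- A measurement table yields a perfect post-processing scheme: measure the table and read off
the coordinate belonging to the announced ensemble. -/
theorem IsMeasurementTable.perfectlyDistinguishable {H : Type*} [NormedAddCommGroup H]
    [InnerProductSpace ℂ H] {KA KB : Type*} [Fintype KA] [Fintype KB]
    {φA : KA → H} {φB : KB → H} {M : KA × KB → H →ₗ[ℂ] H}
    (h : IsMeasurementTable φA φB M) : PerfectlyDistinguishable φA φB := by
  obtain ⟨⟨hpos, hsum⟩, hA, hB⟩ := h
  let E := (Fintype.equivFin (KA × KB)).symm
  refine ⟨_, fun ω => M (E ω), fun ω => (E ω).1, fun ω => (E ω).2,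
    ⟨fun ω => hpos (E ω), (Equiv.sum_comp E M).trans hsum⟩, fun a => ?_, fun b => ?_⟩
  · rw [← hA a, Finset.sum_filter,
      Equiv.sum_comp E (fun p => if p.1 = a then ⟪φA a, M p (φA a)⟫_ℂ else 0),
      Fintype.sum_prod_type_right]
    simp
  · rw [← hB b, Finset.sum_filter,
      Equiv.sum_comp E (fun p => if p.2 = b then ⟪φB b, M p (φB b)⟫_ℂ else 0),
      Fintype.sum_prod_type]
    simp

/-- A nonnegative multiple of `|v⟩⟨v|` has real nonnegative expectation values. -/
theorem inner_smul_inner_smul_nonneg {H : Type*} [NormedAddCommGroup H] [InnerProductSpace ℂ H]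
    {c : ℝ} (hc : 0 ≤ c) (v x : H) :
    0 ≤ (⟪x, (c : ℂ) • (⟪v, x⟫_ℂ • v)⟫_ℂ).re ∧ (⟪x, (c : ℂ) • (⟪v, x⟫_ℂ • v)⟫_ℂ).im = 0 := by
  have h : ⟪x, (c : ℂ) • (⟪v, x⟫_ℂ • v)⟫_ℂ = ((c * ‖⟪v, x⟫_ℂ‖ ^ 2 : ℝ) : ℂ) := by
    rw [inner_smul_right, inner_smul_right, ← inner_conj_symm x v, Complex.mul_conj']
    push_cast
    rfl
  rw [h, Complex.ofReal_re, Complex.ofReal_im]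
  exact ⟨by positivity, rfl⟩

/-- The explicit example in `ℂ³`: the four rank-one operators `(3/4)|v_{ab}⟩⟨v_{ab}|`
with `v_{ab} = (|0⟩ + (-1)^a|1⟩ + (-1)^b|2⟩)/√3` form a POVM which is a measurement
table for `S^A = ((|0⟩±|1⟩)/√2)` and `S^B = ((|0⟩±|2⟩)/√2)`; hence this pair is
perfectly distinguishable by post-processing although all cross overlaps are nonzero. -/
theorem explicit_example_three_dim
    (e : Fin 3 → EuclideanSpace ℂ (Fin 3)) (he : ∀ i, e i = EuclideanSpace.single i 1)
    (φA φB : Fin 2 → EuclideanSpace ℂ (Fin 3))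
    (hφA : ∀ a, φA a = (Real.sqrt 2)⁻¹ • (e 0 + ((-1 : ℂ)) ^ (a : ℕ) • e 1))
    (hφB : ∀ b, φB b = (Real.sqrt 2)⁻¹ • (e 0 + ((-1 : ℂ)) ^ (b : ℕ) • e 2))
    (v : Fin 2 × Fin 2 → EuclideanSpace ℂ (Fin 3))
    (hv : ∀ p, v p = (Real.sqrt 3)⁻¹ •
      (e 0 + ((-1 : ℂ)) ^ (p.1 : ℕ) • e 1 + ((-1 : ℂ)) ^ (p.2 : ℕ) • e 2))
    (M : Fin 2 × Fin 2 → EuclideanSpace ℂ (Fin 3) →ₗ[ℂ] EuclideanSpace ℂ (Fin 3))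
    (hM : ∀ p x, M p x = (3 / 4 : ℂ) • (⟪v p, x⟫_ℂ • v p)) :
    IsPOVM M ∧ IsMeasurementTable φA φB M ∧ PerfectlyDistinguishable φA φB ∧
      ∀ a b, ⟪φA a, φB b⟫_ℂ ≠ 0 := by
  have h2 : ((Real.sqrt 2 : ℂ))⁻¹ ^ 2 = 1 / 2 := by
    rw [inv_pow, ← Complex.ofReal_pow, Real.sq_sqrt (by norm_num)]
    norm_num
  have h3 : ((Real.sqrt 3 : ℂ))⁻¹ ^ 2 = 1 / 3 := by
    rw [inv_pow, ← Complex.ofReal_pow, Real.sq_sqrt (by norm_num)]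
    norm_num
  have hpovm : IsPOVM M := by
    refine ⟨fun p x => ?_, ?_⟩
    · have h := inner_smul_inner_smul_nonneg (c := 3 / 4) (by norm_num) (v p) x
      rw [hM]
      simpa using h
    · ext x i
      fin_cases i <;>
        simp [Fintype.sum_prod_type, hM, hv, he, PiLp.inner_apply, Fin.sum_univ_three]
      · linear_combination 3 * x 0 * h3
      · linear_combination 3 * x 1 * h3
      · linear_combination 3 * x 2 * h3
  have htable : IsMeasurementTable φA φB M := by
    refine ⟨hpovm, fun a => ?_, fun b => ?_⟩
    · fin_cases a <;>
        simp [hM, hv, hφA, he, PiLp.inner_apply] <;>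
        linear_combination 6 * ((Real.sqrt 3 : ℂ))⁻¹ ^ 2 * h2 + 3 * h3
    · fin_cases b <;>
        simp [hM, hv, hφB, he, PiLp.inner_apply] <;>
        linear_combination 6 * ((Real.sqrt 3 : ℂ))⁻¹ ^ 2 * h2 + 3 * h3
  refine ⟨hpovm, htable, htable.perfectlyDistinguishable, fun a b => ?_⟩
  simp [hφA, hφB, he, PiLp.inner_apply]

end
end
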